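/- arXiv:2206.06737 — 3 statements merged into one kernel-verified Lean document; each statement's English description precedes it below -/
import Mathlib

section
/- Let f₁, …, f_M be binary linear classifiers on ℝ^D with fᵢ(u) = ⟨wᵢ, u⟩ + bᵢ, let α₁, …, α_M > 0 with Σᵢ αᵢ = 1, let (x, y) ∈ ℝ^D × {−1, 1}, and let b̄ ∈ ℝ be arbitrary. Define the auxiliary classifier f̄(u) = ⟨w̄, u⟩ + b̄ with w̄ = Σᵢ αᵢ·λᵢ(x)·wᵢ, where λᵢ(x) = (1/2)·(1 + y + (1 − y)·e^{fᵢ(x)}) / (1 + e^{fᵢ(x)}). Then there exists a constant c > 0 such that ∇_x (Σᵢ αᵢ·lᵢ(x, y)) = c · ∇_x l̄(x, y), where l̄ is the binary cross-entropy loss of f̄; in particular the gradient of the expected loss of the ensemble is a positive scalar multiple of the gradient of the loss of the auxiliary classifier. -/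
open scoped RealInnerProductSpace BigOperators Gradient

/-- The binary cross-entropy loss of the binary linear classifier `f(u) = ⟪w, u⟫ + b`
at the labeled point `(x, y)` with `y ∈ {−1, 1}`. -/
noncomputable def bceLoss {D : ℕ} (w : EuclideanSpace ℝ (Fin D)) (b y : ℝ)
    (x : EuclideanSpace ℝ (Fin D)) : ℝ :=
  -((1 + y) / 2) * Real.log (Real.exp (⟪w, x⟫ + b) / (1 + Real.exp (⟪w, x⟫ + b)))
    - ((1 - y) / 2) * Real.log (1 / (1 + Real.exp (⟪w, x⟫ + b)))

/-- `λ(x) = (1/2)·(1 + y + (1 − y)·e^{f(x)}) / (1 + e^{f(x)})` for `f(u) = ⟪w, u⟫ + b`. -/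
noncomputable def lam {D : ℕ} (w : EuclideanSpace ℝ (Fin D)) (b y : ℝ)
    (x : EuclideanSpace ℝ (Fin D)) : ℝ :=
  (1 / 2) * (1 + y + (1 - y) * Real.exp (⟪w, x⟫ + b)) / (1 + Real.exp (⟪w, x⟫ + b))

theorem bceLoss_eq {D : ℕ} (w : EuclideanSpace ℝ (Fin D)) (b y : ℝ)
    (x : EuclideanSpace ℝ (Fin D)) :
    bceLoss w b y x = Real.log (1 + Real.exp (⟪w, x⟫ + b)) - (1 + y) / 2 * (⟪w, x⟫ + b) := by
  have h : 1 + Real.exp (⟪w, x⟫ + b) ≠ 0 := by positivity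
  rw [bceLoss, Real.log_div (Real.exp_ne_zero _) h, Real.log_div one_ne_zero h, Real.log_exp,
    Real.log_one]
  ring

theorem lam_pos {D : ℕ} (w : EuclideanSpace ℝ (Fin D)) (b : ℝ) {y : ℝ} (hy : y = -1 ∨ y = 1)
    (x : EuclideanSpace ℝ (Fin D)) : 0 < lam w b y x := by
  unfold lam
  rcases hy with rfl | rfl <;> norm_num <;> positivity

theorem hasGradientAt_bceLoss {D : ℕ} (w : EuclideanSpace ℝ (Fin D)) (b : ℝ) {y : ℝ}
    (hy : y = -1 ∨ y = 1) (x : EuclideanSpace ℝ (Fin D)) :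
    HasGradientAt (bceLoss w b y) ((-y * lam w b y x) • w) x := by
  have h : 1 + Real.exp (⟪w, x⟫ + b) ≠ 0 := by positivity
  have hf : HasFDerivAt (fun z => ⟪w, z⟫ + b) (innerSL ℝ w) x :=
    (innerSL ℝ w).hasFDerivAt.add_const b
  have hloss := ((hf.exp.const_add 1).log h).sub (hf.const_mul ((1 + y) / 2))
  rw [hasGradientAt_iff_hasFDerivAt, funext (bceLoss_eq w b y)]
  refine hloss.congr_fderiv ?_
  ext v
  simp only [lam, map_smul, InnerProductSpace.toDual_apply_apply, innerSL_apply_apply,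
    sub_apply, smul_apply, smul_eq_mul]
  rcases hy with rfl | rfl <;> field_simp <;> ring

/-- The gradient of the expected binary cross-entropy loss of a randomized ensemble of
binary linear classifiers equals a positive scalar multiple of the gradient of the
binary cross-entropy loss of the auxiliary classifier `f̄(u) = ⟪w̄, u⟫ + b̄` with
`w̄ = Σᵢ αᵢ·λᵢ(x)·wᵢ`, for any choice of bias `b̄`. -/
theorem ensemble_gradient_prop_to_auxiliary
    {D M : ℕ} (hD : 1 ≤ D) (hM : 1 ≤ M)
    (w : Fin M → EuclideanSpace ℝ (Fin D)) (b : Fin M → ℝ)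
    (α : Fin M → ℝ) (hα : ∀ i, 0 < α i) (hsum : ∑ i, α i = 1)
    (x : EuclideanSpace ℝ (Fin D)) (y : ℝ) (hy : y = -1 ∨ y = 1) (bbar : ℝ)
    (wbar : EuclideanSpace ℝ (Fin D))
    (hwbar : wbar = ∑ i, (α i * lam (w i) (b i) y x) • w i) :
    ∃ c : ℝ, 0 < c ∧
      ∇ (fun z => ∑ i, α i * bceLoss (w i) (b i) y z) x =
        c • ∇ (fun z => bceLoss wbar bbar y z) x := by
  have hens : HasGradientAt (fun z => ∑ i, α i * bceLoss (w i) (b i) y z) (-y • wbar) x := by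
    rw [hasGradientAt_iff_hasFDerivAt]
    refine (HasFDerivAt.fun_sum fun i _ =>
      (hasGradientAt_bceLoss (w i) (b i) hy x).hasFDerivAt.const_mul (α i)).congr_fderiv ?_
    rw [hwbar, Finset.smul_sum, map_sum]
    refine Finset.sum_congr rfl fun i _ => ?_
    simp only [map_smul, smul_smul]
    congr 1
    ring
  have hpos := lam_pos wbar bbar hy x
  refine ⟨(lam wbar bbar y x)⁻¹, inv_pos.2 hpos, ?_⟩
  rw [hens.gradient, (hasGradientAt_bceLoss wbar bbar hy x).gradient, smul_smul]
  congr 1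
  field_simp
end

section
/- Let D ≥ 1, w ∈ ℝ^D with w ≠ 0, b > 0, and p, q > 1 real with 1/p + 1/q = 1. Define the two binary linear classifiers f₁(u) = ⟨w, u⟩ + b and f₂(u) = −⟨w, u⟩ + b, take x = 0, y = 1, ε = 2b·‖w‖_p / ‖w‖₂², and δ = ε·w/‖w‖_p. Then f₁(x) > 0 and f₂(x) > 0 (both classifiers correctly classify x), ‖δ‖_p = ε, f₁(x + δ) = 3b > 0, and f₂(x + δ) = −b < 0; consequently, for equiprobable sampling α = (1/2, 1/2), the expected accuracy satisfies L(x + δ, y, α) = 1/2 < 1 = L(x, y, α). -/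
open scoped RealInnerProductSpace BigOperators

/-- The ℓp norm `(∑ i, |v i|^p)^(1/p)` on `ℝ^D` for a real exponent `p`. -/
noncomputable def lpNorm {D : ℕ} (p : ℝ) (v : EuclideanSpace ℝ (Fin D)) : ℝ :=
  (∑ i, |v i| ^ p) ^ (1 / p)

open Classical in
/-- Real-valued indicator of a proposition. -/
noncomputable def ind (P : Prop) : ℝ := if P then 1 else 0

theorem lpNorm_pos {D : ℕ} {p : ℝ} {v : EuclideanSpace ℝ (Fin D)} (hv : v ≠ 0) :
    0 < lpNorm p v := by
  obtain ⟨i, hi⟩ : ∃ i, v i ≠ 0 := by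
    by_contra! h
    exact hv (PiLp.ext h)
  refine Real.rpow_pos_of_pos (Finset.sum_pos' (fun j _ => by positivity) ?_) _
  exact ⟨i, Finset.mem_univ i, Real.rpow_pos_of_pos (abs_pos.mpr hi) p⟩

theorem lpNorm_smul {D : ℕ} {p : ℝ} (hp : p ≠ 0) (c : ℝ) (v : EuclideanSpace ℝ (Fin D)) :
    lpNorm p (c • v) = |c| * lpNorm p v := by
  have h (i : Fin D) : |(c • v) i| ^ p = |c| ^ p * |v i| ^ p := by
    rw [PiLp.smul_apply, smul_eq_mul, abs_mul, Real.mul_rpow (abs_nonneg _) (abs_nonneg _)]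
  have hc : (|c| ^ p) ^ (1 / p) = |c| := by
    rw [one_div, Real.rpow_rpow_inv (abs_nonneg c) hp]
  unfold lpNorm
  rw [Finset.sum_congr rfl fun i _ => h i, ← Finset.mul_sum,
    Real.mul_rpow (by positivity) (Finset.sum_nonneg fun i _ => by positivity), hc]

theorem lpNorm_two {D : ℕ} (v : EuclideanSpace ℝ (Fin D)) : lpNorm 2 v = ‖v‖ := by
  simp [lpNorm, EuclideanSpace.norm_eq, Real.sqrt_eq_rpow]

/-- The explicit counterexample used to show APGD is inconsistent: for the two binary
linear classifiers `f₁(u) = ⟪w, u⟫ + b` and `f₂(u) = −⟪w, u⟫ + b` with `b > 0`, the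
point `x = 0` with label `y = 1`, radius `ε = 2b·‖w‖_p/‖w‖₂²`, and perturbation
`δ = ε·w/‖w‖_p`: both classifiers correctly classify `x`, `‖δ‖_p = ε`,
`f₁(x + δ) = 3b > 0`, `f₂(x + δ) = −b < 0`, and for equiprobable sampling the expected
accuracy satisfies `L(x + δ, y, α) = 1/2 < 1 = L(x, y, α)`. -/
theorem apgd_counterexample_geometry
    {D : ℕ} (hD : 1 ≤ D) (w : EuclideanSpace ℝ (Fin D)) (hw : w ≠ 0)
    (b : ℝ) (hb : 0 < b)
    (p q : ℝ) (hp : 1 < p) (hq : 1 < q) (hpq : 1 / p + 1 / q = 1)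
    (x : EuclideanSpace ℝ (Fin D)) (hx : x = 0) (y : ℝ) (hy : y = 1)
    (ε : ℝ) (hε : ε = 2 * b * lpNorm p w / (lpNorm 2 w) ^ (2 : ℕ))
    (δ : EuclideanSpace ℝ (Fin D)) (hδ : δ = (ε / lpNorm p w) • w) :
    0 < y * (⟪w, x⟫ + b) ∧
    0 < y * (-⟪w, x⟫ + b) ∧
    lpNorm p δ = ε ∧
    ⟪w, x + δ⟫ + b = 3 * b ∧ 0 < 3 * b ∧
    -⟪w, x + δ⟫ + b = -b ∧ -b < 0 ∧
    (1 / 2) * ind (0 < y * (⟪w, x + δ⟫ + b)) + (1 / 2) * ind (0 < y * (-⟪w, x + δ⟫ + b))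
      = 1 / 2 ∧
    (1 / 2) * ind (0 < y * (⟪w, x⟫ + b)) + (1 / 2) * ind (0 < y * (-⟪w, x⟫ + b)) = 1 ∧
    (1 / 2 : ℝ) < 1 := by
  have hP : 0 < lpNorm p w := lpNorm_pos hw
  have hn : 0 < ‖w‖ := norm_pos_iff.mpr hw
  have hε_pos : 0 < ε := by
    rw [hε, lpNorm_two]
    positivity
  have hx0 : ⟪w, x⟫ = 0 := by rw [hx, inner_zero_right]
  have hxδ : ⟪w, x + δ⟫ = 2 * b := by
    rw [hx, zero_add, hδ, real_inner_smul_right, real_inner_self_eq_norm_sq, hε, lpNorm_two]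
    field_simp
  have hδ_norm : lpNorm p δ = ε := by
    rw [hδ, lpNorm_smul (by linarith), abs_of_pos (by positivity), div_mul_cancel₀ _ hP.ne']
  have h₁ : 0 < 2 * b + b := by linarith
  have h₂ : ¬0 < -(2 * b) + b := by linarith
  rw [hy, hx0, hxδ]
  simp only [one_mul, neg_zero, zero_add]
  refine ⟨hb, hb, hδ_norm, by ring, by linarith, by ring, by linarith, ?_, ?_, by norm_num⟩
  · rw [ind, ind, if_pos h₁, if_neg h₂]
    norm_num
  · rw [ind, if_pos hb]
    norm_num
end

section
/- Let D ≥ 1, w ∈ ℝ^D with w ≠ 0, b > 0, and define the binary linear classifiers f₁(u) = ⟨w, u⟩ + b and f₂(u) = −⟨w, u⟩ + b, with x = 0, y = 1, and equiprobable weights α₁ = α₂ = 1/2. Then for every δ ∈ ℝ^D with ⟨w, δ⟩ = 0, the gradient of the expected binary cross-entropy loss vanishes at x + δ: ∇_x ((1/2)·l₁(x + δ, y) + (1/2)·l₂(x + δ, y)) = 0. -/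
open scoped RealInnerProductSpace BigOperators Gradient

/-- The binary cross-entropy loss of a linear classifier depends on the point only through
`⟪w, x⟫`, so its gradient is a multiple of `w` by the derivative of the scalar loss. -/
theorem hasGradientAt_bceLoss_s9 {D : ℕ} (w : EuclideanSpace ℝ (Fin D)) (b y : ℝ)
    (z : EuclideanSpace ℝ (Fin D)) :
    HasGradientAt (bceLoss w b y) (deriv (fun t : ℝ =>
      -((1 + y) / 2) * Real.log (Real.exp (t + b) / (1 + Real.exp (t + b)))
        - ((1 - y) / 2) * Real.log (1 / (1 + Real.exp (t + b)))) ⟪w, z⟫ • w) z := by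
  have hφ : DifferentiableAt ℝ (fun t : ℝ =>
      -((1 + y) / 2) * Real.log (Real.exp (t + b) / (1 + Real.exp (t + b)))
        - ((1 - y) / 2) * Real.log (1 / (1 + Real.exp (t + b)))) ⟪w, z⟫ := by
    have hpos (t : ℝ) : 1 + Real.exp t ≠ 0 := by positivity
    fun_prop (disch := first | exact hpos _ | positivity)
  have h := hφ.hasDerivAt.comp_hasFDerivAt z (innerSL ℝ w).hasFDerivAt
  rw [hasGradientAt_iff_hasFDerivAt]
  refine h.congr_fderiv ?_
  ext v
  simp

/-- For the two binary linear classifiers `f₁(u) = ⟪w, u⟫ + b` and `f₂(u) = −⟪w, u⟫ + b`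
with `b > 0`, the point `x = 0`, label `y = 1`, and equiprobable weights, the gradient of
the expected binary cross-entropy loss vanishes at `x + δ` for every `δ` with
`⟪w, δ⟫ = 0`. -/
theorem apgd_gradient_vanishes
    {D : ℕ} (hD : 1 ≤ D) (w : EuclideanSpace ℝ (Fin D)) (hw : w ≠ 0)
    (b : ℝ) (hb : 0 < b)
    (x : EuclideanSpace ℝ (Fin D)) (hx : x = 0) (y : ℝ) (hy : y = 1)
    (δ : EuclideanSpace ℝ (Fin D)) (hδ : ⟪w, δ⟫ = 0) :
    ∇ (fun z => (1 / 2) * bceLoss w b y z + (1 / 2) * bceLoss (-w) b y z) (x + δ) = 0 := by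
  subst hx
  have h₁ := hasGradientAt_bceLoss_s9 w b y (0 + δ)
  have h₂ := hasGradientAt_bceLoss_s9 (-w) b y (0 + δ)
  have hδ' : ⟪w, 0 + δ⟫ = 0 := by rwa [zero_add]
  rw [inner_neg_left, hδ', neg_zero] at h₂
  rw [hδ'] at h₁
  refine HasGradientAt.gradient ?_
  rw [hasGradientAt_iff_hasFDerivAt] at *
  refine ((h₁.const_mul (1 / 2)).add (h₂.const_mul (1 / 2))).congr_fderiv ?_
  simp
end
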